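/- arXiv:2111.04853 — 2 statements merged into one kernel-verified Lean document; each statement's English description precedes it below -/
import Mathlib

section
/- Let k be an infinite field, d ≥ 1, and let I be a homogeneous SL₂(k)-invariant of degree s ≥ 1 for binary forms of degree d over k. If f is a binary form of degree d over k that is divisible in k[x,y] by (βx − αy)^r for some (α,β) ∈ k² with (α,β) ≠ (0,0) and some integer r with 2r > d, then I(f) = 0. -/
open MvPolynomial

/-- The binary form of degree `d` with coefficient tuple `a`:
`f(x,y) = Σ_{i=0}^d a_i x^i y^{d-i}`, as a polynomial in `x = X 0`, `y = X 1`. -/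
noncomputable def binForm {k : Type*} [CommRing k] (d : ℕ) (a : Fin (d + 1) → k) :
    MvPolynomial (Fin 2) k :=
  ∑ i : Fin (d + 1), C (a i) * X 0 ^ (i : ℕ) * X 1 ^ (d - (i : ℕ))

/-- The coefficient tuple of the transformed form
`f^M(x,y) = f(M₀₀x + M₀₁y, M₁₀x + M₁₁y)`:  `transCoeff M d a i` is the coefficient
of `x^i y^{d-i}` in `f^M`. -/
noncomputable def transCoeff {k : Type*} [CommRing k] (M : Matrix (Fin 2) (Fin 2) k)
    (d : ℕ) (a : Fin (d + 1) → k) : Fin (d + 1) → k :=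
  fun i => MvPolynomial.coeff
    (Finsupp.single (0 : Fin 2) (i : ℕ) + Finsupp.single (1 : Fin 2) (d - (i : ℕ)))
    (MvPolynomial.bind₁ (fun j : Fin 2 => C (M j 0) * X 0 + C (M j 1) * X 1) (binForm d a))

/-- `I ∈ k[a₀, …, a_d]` is a homogeneous `SL₂(k)`-invariant of degree `s` for binary
forms of degree `d`: it is homogeneous of degree `s` in the coefficient variables and
`I(f^M) = I(f)` for every binary form `f` of degree `d` and every `M ∈ SL₂(k)`. -/
def IsBinaryInvariant {k : Type*} [CommRing k] (d s : ℕ) (I : MvPolynomial (Fin (d + 1)) k) :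
    Prop :=
  I.IsHomogeneous s ∧
    ∀ (a : Fin (d + 1) → k) (M : Matrix (Fin 2) (Fin 2) k), M.det = 1 →
      MvPolynomial.eval (transCoeff M d a) I = MvPolynomial.eval a I

lemma coeff_binForm_aux {k : Type*} [CommRing k] (d : ℕ) (a : Fin (d + 1) → k) (i : Fin (d + 1)) :
    MvPolynomial.coeff
      (Finsupp.single (0 : Fin 2) (i : ℕ) + Finsupp.single (1 : Fin 2) (d - (i : ℕ)))
      (binForm d a) = a i := by
  have key : ∀ j : Fin (d + 1), (C (a j) * X 0 ^ (j : ℕ) * X 1 ^ (d - (j : ℕ)) :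
      MvPolynomial (Fin 2) k) = monomial
      (Finsupp.single (0 : Fin 2) (j : ℕ) + Finsupp.single (1 : Fin 2) (d - (j : ℕ))) (a j) := by
    intro j
    rw [X_pow_eq_monomial, X_pow_eq_monomial, C_mul_monomial, monomial_mul]
    simp
  unfold binForm
  simp only [key]
  rw [coeff_sum, Finset.sum_eq_single i]
  · simp
  · intro j _ hj
    rw [coeff_monomial, if_neg]
    intro h
    have := DFunLike.congr_fun h 0
    simp at this
    exact hj (Fin.ext this)
  · simp

lemma transCoeff_diag_aux {k : Type*} [CommRing k] (d : ℕ) (b : Fin (d + 1) → k) (t u : k)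
    (i : Fin (d + 1)) :
    transCoeff !![t, 0; 0, u] d b i = t ^ (i : ℕ) * u ^ (d - (i : ℕ)) * b i := by
  have : MvPolynomial.bind₁ (fun j : Fin 2 => C ((!![t, 0; 0, u] : Matrix (Fin 2) (Fin 2) k) j 0)
      * X 0 + C ((!![t, 0; 0, u] : Matrix (Fin 2) (Fin 2) k) j 1) * X 1) (binForm d b)
      = binForm d (fun i => t ^ (i : ℕ) * u ^ (d - (i : ℕ)) * b i) := by
    unfold binForm
    rw [map_sum]
    refine Finset.sum_congr rfl fun j _ => ?_
    simp only [map_mul, map_pow, bind₁_X_right, bind₁_C_right]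
    simp
    ring
  unfold transCoeff
  rw [this, coeff_binForm_aux]

lemma vanish_normal_aux {k : Type*} [Field k] [Infinite k]
    (d s : ℕ) (hs : 1 ≤ s)
    (I : MvPolynomial (Fin (d + 1)) k) (hI : IsBinaryInvariant d s I)
    (b : Fin (d + 1) → k) (hb : ∀ i : Fin (d + 1), 2 * (i : ℕ) ≤ d → b i = 0) :
    MvPolynomial.eval b I = 0 := by
  let g : Fin (d + 1) → Polynomial k := fun i => Polynomial.C (b i) * Polynomial.X ^ (2 * (i : ℕ) - d)
  let P : Polynomial k := MvPolynomial.aeval g I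
  have hP : ∀ t : k, P.eval t = MvPolynomial.eval (fun i => b i * t ^ (2 * (i : ℕ) - d)) I := by
    intro t
    have : P.eval t = Polynomial.aeval t (MvPolynomial.aeval g I) := by
      simp [P, Polynomial.coe_aeval_eq_eval]
    rw [this, MvPolynomial.comp_aeval_apply, ← MvPolynomial.coe_aeval_eq_eval]
    simp [g]
  have h1 : ∀ t : k, t ≠ 0 → P.eval t = MvPolynomial.eval b I := by
    intro t ht
    rw [hP, ← hI.2 b !![t, 0; 0, t⁻¹] (by simp [Matrix.det_fin_two, ht])]
    congr 2
    funext i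
    rw [transCoeff_diag_aux]
    by_cases h : 2 * (i : ℕ) ≤ d
    · simp [hb i h]
    · have hi := i.2
      have e : (i : ℕ) = (2 * (i : ℕ) - d) + (d - (i : ℕ)) := by omega
      have e2 : t ^ (i : ℕ) = t ^ (2 * (i : ℕ) - d) * t ^ (d - (i : ℕ)) := by
        rw [← pow_add, ← e]
      rw [e2, inv_pow, mul_assoc (t ^ _), mul_inv_cancel₀ (pow_ne_zero _ ht)]
      ring
  have h2 : P = Polynomial.C (MvPolynomial.eval b I) := by
    refine Polynomial.eq_of_infinite_eval_eq _ _ ?_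
    refine (Set.Finite.infinite_compl (Set.finite_singleton (0 : k))).mono ?_
    intro t ht
    simpa using h1 t (by simpa using ht)
  have h3 : P.eval 0 = 0 := by
    have hz : (fun i : Fin (d + 1) => b i * (0 : k) ^ (2 * (i : ℕ) - d)) = fun i => 0 * (0 : k) := by
      funext i
      by_cases h : 2 * (i : ℕ) ≤ d
      · simp [hb i h]
      · rw [zero_pow (by omega)]; simp
    rw [hP, hz]
    have hc : constantCoeff I = 0 := by
      rw [constantCoeff_eq]
      refine hI.1.coeff_eq_zero ?_
      simp; omega
    simp only [mul_zero]
    rw [MvPolynomial.eval_zero', hc]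
  rw [h2] at h3
  simpa using h3

/-- over an infinite field `k`, if a binary form `f` of degree `d ≥ 1` is
divisible by `(βx − αy)^r` for some `(α,β) ≠ (0,0)` and some `r` with `2r > d`, then
every homogeneous `SL₂(k)`-invariant `I` of degree `s ≥ 1` vanishes at `f`. -/
theorem invariant_vanishes_of_high_multiplicity_root {k : Type*} [Field k] [Infinite k]
    (d s : ℕ) (hd : 1 ≤ d) (hs : 1 ≤ s)
    (I : MvPolynomial (Fin (d + 1)) k) (hI : IsBinaryInvariant d s I)
    (a : Fin (d + 1) → k) (α β : k) (hαβ : (α, β) ≠ (0, 0))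
    (r : ℕ) (hr : d < 2 * r)
    (hdiv : (C β * X 0 - C α * X 1) ^ r ∣ binForm d a) :
    MvPolynomial.eval a I = 0 := by
  obtain ⟨p, q, hpq⟩ : ∃ p q : k, p * β - α * q = 1 := by
    by_cases hβ : β = 0
    · have hα : α ≠ 0 := fun h => hαβ (by rw [h, hβ])
      exact ⟨0, -α⁻¹, by field_simp; simp⟩
    · exact ⟨β⁻¹, 0, by simp [hβ]⟩
  rw [← hI.2 a !![p, α; q, β] (by simpa [Matrix.det_fin_two] using hpq)]
  refine vanish_normal_aux d s hs I hI _ fun i hi => ?_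
  obtain ⟨g, hg⟩ := hdiv
  unfold transCoeff
  rw [hg, map_mul, map_pow]
  have hx : bind₁ (fun j : Fin 2 => C ((!![p, α; q, β] : Matrix (Fin 2) (Fin 2) k) j 0)
      * X 0 + C ((!![p, α; q, β] : Matrix (Fin 2) (Fin 2) k) j 1) * X 1)
      (C β * X 0 - C α * X 1 : MvPolynomial (Fin 2) k) = (X 0 : MvPolynomial (Fin 2) k) := by
    simp only [map_sub, map_mul, bind₁_X_right, bind₁_C_right]
    simp
    have : (C (p * β - α * q) : MvPolynomial (Fin 2) k) = 1 := by rw [hpq, C_1]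
    simp only [map_sub, map_mul] at this
    linear_combination (X 0) * this
  rw [hx, X_pow_eq_monomial, coeff_monomial_mul', if_neg]
  intro h
  have := h 0
  simp at this
  omega
end

section
/- Let k be an algebraically closed field and d = 2m an even positive integer. Let f and g be binary forms of degree d over k, each having a linear factor of multiplicity exactly m (i.e., f is divisible by ℓ^m but not ℓ^{m+1} for some nonzero linear form ℓ, and similarly for g). Then there exists λ ∈ k* such that for every integer s ≥ 1 and every homogeneous SL₂(k)-invariant I of degree s for binary forms of degree d, one has I(f) = λ^s · I(g). In particular, all binary forms of even degree d with a root of multiplicity exactly d/2 determine the same point of the weighted moduli space. -/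
open MvPolynomial

section Helpers

variable {k : Type*} [Field k]

lemma expo_inj {d : ℕ} {i j : ℕ}
    (h : Finsupp.single (0 : Fin 2) i + Finsupp.single (1 : Fin 2) (d - i) =
      Finsupp.single (0 : Fin 2) j + Finsupp.single (1 : Fin 2) (d - j)) : i = j := by
  have := DFunLike.congr_fun h 0
  simpa using this

lemma binForm_eq_monomial (d : ℕ) (a : Fin (d + 1) → k) :
    binForm d a = ∑ i : Fin (d + 1), monomial
      (Finsupp.single (0 : Fin 2) (i : ℕ) + Finsupp.single (1 : Fin 2) (d - (i : ℕ))) (a i) := by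
  unfold binForm
  refine Finset.sum_congr rfl fun i _ => ?_
  rw [mul_assoc, X_pow_eq_monomial, X_pow_eq_monomial, monomial_mul, C_mul_monomial]
  simp

lemma coeff_binForm (d : ℕ) (a : Fin (d + 1) → k) (i : Fin (d + 1)) :
    coeff (Finsupp.single (0 : Fin 2) (i : ℕ) + Finsupp.single (1 : Fin 2) (d - (i : ℕ)))
      (binForm d a) = a i := by
  classical
  rw [binForm_eq_monomial, coeff_sum, Finset.sum_eq_single i]
  · simp [coeff_monomial]
  · intro j _ hj
    rw [coeff_monomial, if_neg]
    intro h
    exact hj (Fin.ext (expo_inj h))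
  · simp

lemma binForm_homog (d : ℕ) (a : Fin (d + 1) → k) : (binForm d a).IsHomogeneous d := by
  rw [binForm_eq_monomial]
  refine IsHomogeneous.sum _ _ _ fun i _ => isHomogeneous_monomial _ ?_
  have := i.2
  simp [Finsupp.degree_eq_sum]
  omega

lemma homog_eq_binForm (d : ℕ) (p : MvPolynomial (Fin 2) k) (hp : p.IsHomogeneous d) :
    binForm d (fun i => coeff (Finsupp.single (0 : Fin 2) (i : ℕ) +
      Finsupp.single (1 : Fin 2) (d - (i : ℕ))) p) = p := by
  ext n
  by_cases hn : n.degree = d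
  · have h2 : n 0 + n 1 = d := by
      rw [Finsupp.degree_eq_sum] at hn
      simpa using hn
    have hn' : n = Finsupp.single (0 : Fin 2) (n 0) + Finsupp.single (1 : Fin 2) (d - n 0) := by
      ext j
      fin_cases j
      · simp
      · simp; omega
    have := coeff_binForm d (fun i => coeff (Finsupp.single (0 : Fin 2) (i : ℕ) +
      Finsupp.single (1 : Fin 2) (d - (i : ℕ))) p) ⟨n 0, by omega⟩
    simp only at this
    rw [← hn'] at this
    exact this
  · rw [(binForm_homog d _).coeff_eq_zero hn, hp.coeff_eq_zero hn]

lemma binForm_transCoeff (M : Matrix (Fin 2) (Fin 2) k) (d : ℕ) (a : Fin (d + 1) → k) :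
    binForm d (transCoeff M d a) =
      bind₁ (fun j : Fin 2 => C (M j 0) * X 0 + C (M j 1) * X 1) (binForm d a) := by
  unfold transCoeff
  apply homog_eq_binForm
  have := (binForm_homog d a).aeval
    (fun j : Fin 2 => C (M j 0) * X 0 + C (M j 1) * X 1 : Fin 2 → MvPolynomial (Fin 2) k) (n := 1)
    (fun j => (isHomogeneous_C_mul_X _ _).add (isHomogeneous_C_mul_X _ _))
  rw [one_mul] at this
  exact this

lemma transCoeff_diag (u v : k) (d : ℕ) (a : Fin (d + 1) → k) (i : Fin (d + 1)) :
    transCoeff !![u, 0; 0, v] d a i = a i * u ^ (i : ℕ) * v ^ (d - (i : ℕ)) := by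
  have h : bind₁ (fun j : Fin 2 => C ((!![u, 0; 0, v] : Matrix (Fin 2) (Fin 2) k) j 0) * X 0 +
      C ((!![u, 0; 0, v] : Matrix (Fin 2) (Fin 2) k) j 1) * X 1) (binForm d a) =
      binForm d (fun i => a i * u ^ (i : ℕ) * v ^ (d - (i : ℕ))) := by
    unfold binForm
    rw [map_sum]
    refine Finset.sum_congr rfl fun i _ => ?_
    simp [bind₁_X_right]
    ring
  unfold transCoeff
  rw [h, coeff_binForm]

lemma coeff_zero_of_dvd (m d : ℕ) (a : Fin (d + 1) → k) (h : X 0 ^ m ∣ binForm d a)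
    (i : Fin (d + 1)) (hi : (i : ℕ) < m) : a i = 0 := by
  classical
  obtain ⟨q, hq⟩ := h
  rw [← coeff_binForm d a i, hq, X_pow_eq_monomial, coeff_monomial_mul', if_neg]
  intro hle
  have := hle 0
  simp at this
  omega

lemma dvd_of_coeff_zero (m d : ℕ) (a : Fin (d + 1) → k)
    (h : ∀ i : Fin (d + 1), (i : ℕ) < m → a i = 0) : X 0 ^ m ∣ binForm d a := by
  unfold binForm
  refine Finset.dvd_sum fun i _ => ?_
  by_cases hi : (i : ℕ) < m
  · simp [h i hi]
  · exact ((pow_dvd_pow _ (not_lt.mp hi)).mul_left _).mul_right _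

lemma eval_homog_scale {σ : Type*} {s : ℕ} {I : MvPolynomial σ k} (hI : I.IsHomogeneous s)
    (c : k) (e : σ → k) : eval (fun i => c * e i) I = c ^ s * eval e I := by
  rw [eval_eq, eval_eq, Finset.mul_sum]
  refine Finset.sum_congr rfl fun n hn => ?_
  have hd : ∑ i ∈ n.support, n i = s := (hI.degree_eq_sum_deg_support hn).symm
  simp only [mul_pow, Finset.prod_mul_distrib, Finset.prod_pow_eq_pow_sum, hd]
  ring

/-- The degeneration of a form `x^m h` under the diagonal torus. -/
lemma eval_degenerate [Infinite k] (m s : ℕ) (a : Fin (2 * m + 1) → k)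
    (h0 : ∀ i : Fin (2 * m + 1), (i : ℕ) < m → a i = 0)
    (I : MvPolynomial (Fin (2 * m + 1)) k) (hI : IsBinaryInvariant (2 * m) s I) :
    eval a I = eval (fun i : Fin (2 * m + 1) => if (i : ℕ) = m then a i else 0) I := by
  let w : Fin (2 * m + 1) → Polynomial k :=
    fun i => Polynomial.C (a i) * Polynomial.X ^ (2 * ((i : ℕ) - m))
  let P : Polynomial k := aeval w I
  have hP : ∀ t : k, P.eval t = eval (fun i => a i * t ^ (2 * ((i : ℕ) - m))) I := by
    intro t
    have h1 : Polynomial.aeval t (aeval w I) = aeval (fun i => Polynomial.aeval t (w i)) I := by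
      rw [← AlgHom.comp_apply, comp_aeval]
    rw [Polynomial.coe_aeval_eq_eval] at h1
    rw [show P.eval t = _ from h1, aeval_eq_eval]
    simp [w]
  have hconst : P = Polynomial.C (eval a I) := by
    apply Polynomial.eq_of_infinite_eval_eq
    refine (Set.finite_singleton (0 : k)).infinite_compl.mono ?_
    intro t ht
    have ht : t ≠ 0 := by simpa using ht
    simp only [Set.mem_ofPred_eq, Polynomial.eval_C]
    rw [hP, ← hI.2 a !![t, 0; 0, t⁻¹] (by simp [Matrix.det_fin_two, ht])]
    congr 2
    funext i
    rw [transCoeff_diag]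
    by_cases hi : (i : ℕ) < m
    · simp [h0 i hi]
    · rw [mul_assoc]
      congr 1
      obtain ⟨j, hj⟩ := Nat.exists_eq_add_of_le (not_lt.mp hi)
      have hlt := i.2
      obtain ⟨l, hl⟩ : ∃ l, m = j + l := ⟨m - j, by omega⟩
      have e1 : 2 * m - (i : ℕ) = l := by omega
      have e2 : (i : ℕ) = 2 * j + l := by omega
      have e3 : 2 * ((i : ℕ) - m) = 2 * j := by omega
      rw [e3, e1, e2, pow_add, mul_assoc, ← mul_pow, mul_inv_cancel₀ ht, one_pow, mul_one]
  have h2 := hP 0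
  rw [hconst, Polynomial.eval_C] at h2
  rw [h2]
  congr 2
  funext i
  rcases lt_trichotomy (i : ℕ) m with hi | hi | hi
  · simp [h0 i hi]
  · simp [hi]
  · have : 2 * ((i : ℕ) - m) ≠ 0 := by omega
    simp [this, hi.ne']

lemma exists_scale [Infinite k] (m : ℕ) (a : Fin (2 * m + 1) → k)
    (ha : ∃ α β : k, (α, β) ≠ (0, 0) ∧
      (C α * X 0 + C β * X 1) ^ m ∣ binForm (2 * m) a ∧
      ¬ (C α * X 0 + C β * X 1) ^ (m + 1) ∣ binForm (2 * m) a) :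
    ∃ c : k, c ≠ 0 ∧ ∀ (s : ℕ) (I : MvPolynomial (Fin (2 * m + 1)) k),
      IsBinaryInvariant (2 * m) s I →
        eval a I = c ^ s * eval (fun i : Fin (2 * m + 1) => if (i : ℕ) = m then 1 else 0) I := by
  obtain ⟨α, β, hne, hdvd, hndvd⟩ := ha
  obtain ⟨p, q, hpq⟩ : ∃ p q : k, α * p + β * q = 1 := by
    by_cases hα : α = 0
    · have hβ : β ≠ 0 := fun h => hne (by simp [hα, h])
      exact ⟨0, β⁻¹, by simp [hβ]⟩
    · exact ⟨α⁻¹, 0, by simp [hα]⟩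
  have hC : (C α * C p + C β * C q : MvPolynomial (Fin 2) k) = 1 := by
    rw [← C_mul, ← C_mul, ← C_add, hpq, C_1]
  let M : Matrix (Fin 2) (Fin 2) k := !![p, -β; q, α]
  have hM : M.det = 1 := by
    simp only [M, Matrix.det_fin_two_of]
    linear_combination hpq
  have hT := binForm_transCoeff M (2 * m) a
  have hz : ∀ i : Fin (2 * m + 1), (i : ℕ) < m → transCoeff M (2 * m) a i = 0 := by
    refine coeff_zero_of_dvd m (2 * m) _ ?_
    rw [hT]
    have := map_dvd (bind₁ (fun j : Fin 2 =>
      (C (M j 0) * X 0 + C (M j 1) * X 1 : MvPolynomial (Fin 2) k))) hdvd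
    have hl : bind₁ (fun j : Fin 2 => C (M j 0) * X 0 + C (M j 1) * X 1)
        (C α * X 0 + C β * X 1) = (X 0 : MvPolynomial (Fin 2) k) := by
      simp [M, bind₁_X_right]
      linear_combination (X 0) * hC
    rwa [map_pow, hl] at this
  have hc : transCoeff M (2 * m) a ⟨m, by omega⟩ ≠ 0 := by
    intro hc
    apply hndvd
    have h1 : X 0 ^ (m + 1) ∣ binForm (2 * m) (transCoeff M (2 * m) a) := by
      refine dvd_of_coeff_zero _ _ _ fun i hi => ?_
      rcases Nat.lt_succ_iff_lt_or_eq.mp hi with h | h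
      · exact hz i h
      · rw [← hc]
        congr 1
        exact Fin.ext h
    rw [hT] at h1
    let N : Fin 2 → MvPolynomial (Fin 2) k :=
      ![C α * X 0 + C β * X 1, - C q * X 0 + C p * X 1]
    have h2 := map_dvd (bind₁ N) h1
    have h3 : bind₁ N (bind₁ (fun j : Fin 2 => C (M j 0) * X 0 + C (M j 1) * X 1)
        (binForm (2 * m) a)) = binForm (2 * m) a := by
      rw [bind₁_bind₁]
      have : (fun i => bind₁ N ((fun j : Fin 2 => C (M j 0) * X 0 + C (M j 1) * X 1) i)) = X := by
        funext j
        fin_cases j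
        · simp [M, N, bind₁_X_right]
          linear_combination (X 0) * hC
        · simp [M, N, bind₁_X_right]
          linear_combination (X 1) * hC
      rw [this]
      simp
    rw [h3] at h2
    simpa [N, bind₁_X_right] using h2
  refine ⟨_, hc, fun s I hI => ?_⟩
  rw [← hI.2 a M hM, eval_degenerate m s _ hz I hI, ← eval_homog_scale hI.1]
  congr 2
  funext i
  by_cases hi : (i : ℕ) = m
  · have : i = ⟨m, by omega⟩ := Fin.ext hi
    rw [this]
    simp
  · simp [hi]

end Helpers

/-- over an algebraically closed field `k`, let `d = 2m` be even and
positive, and let `f`, `g` be binary forms of degree `d`, each having a linear factor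
of multiplicity exactly `m`.  Then there is a `λ ∈ k*` such that every homogeneous
`SL₂(k)`-invariant `I` of degree `s ≥ 1` satisfies `I(f) = λ^s · I(g)`; i.e. all binary
forms of even degree `d` with a root of multiplicity exactly `d/2` determine the same
point of the weighted moduli space. -/
theorem strictly_semistable_forms_same_moduli_point {k : Type*} [Field k] [IsAlgClosed k]
    (m : ℕ) (hm : 1 ≤ m) (a b : Fin (2 * m + 1) → k)
    (ha : ∃ α β : k, (α, β) ≠ (0, 0) ∧
      (C α * X 0 + C β * X 1) ^ m ∣ binForm (2 * m) a ∧
      ¬ (C α * X 0 + C β * X 1) ^ (m + 1) ∣ binForm (2 * m) a)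
    (hb : ∃ α β : k, (α, β) ≠ (0, 0) ∧
      (C α * X 0 + C β * X 1) ^ m ∣ binForm (2 * m) b ∧
      ¬ (C α * X 0 + C β * X 1) ^ (m + 1) ∣ binForm (2 * m) b) :
    ∃ lam : k, lam ≠ 0 ∧
      ∀ (s : ℕ), 1 ≤ s → ∀ I : MvPolynomial (Fin (2 * m + 1)) k,
        IsBinaryInvariant (2 * m) s I →
          MvPolynomial.eval a I = lam ^ s * MvPolynomial.eval b I := by
  have : Infinite k := inferInstance
  obtain ⟨c, hc, hc'⟩ := exists_scale m a ha
  obtain ⟨e, he, he'⟩ := exists_scale m b hb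
  refine ⟨c / e, div_ne_zero hc he, fun s _ I hI => ?_⟩
  rw [hc' s I hI, he' s I hI, div_pow, ← mul_assoc, div_mul_cancel₀ _ (pow_ne_zero s he)]
end
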